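/- arXiv:2510.19950 — 6 statements merged into one kernel-verified Lean document; each statement's English description precedes it below -/
import Mathlib

section
/- Let d ≥ 1 and N ≥ 1 be natural numbers, let p ∈ [1, ∞) be a real exponent, and denote by ‖u‖_p = (∑_{j=1}^d |u_j|^p)^{1/p} the ℓp norm on ℝ^d and by 𝟙 ∈ ℝ^d the all-ones vector. Let v ∈ ℝ^d, let u_1, …, u_N ∈ ℝ^d, and let β > 0. Assume the Slater condition: there exists u_0 ∈ ℝ^d with ∑_{i=1}^N ‖u_0 − u_i‖_p < β and 𝟙ᵀu_0 = 0. Then the minimum of vᵀu over the set {u ∈ ℝ^d : ∑_{i=1}^N ‖u − u_i‖_p ≤ β and 𝟙ᵀu = 0} is attained, and it equals the supremum over λ ≥ 0 and μ ∈ ℝ of the dual value −λβ + inf_{u ∈ ℝ^d} [ (v + μ𝟙)ᵀu + λ ∑_{i=1}^N ‖u − u_i‖_p ] (where the inner infimum is taken in the extended reals). -/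
open Finset

/-- Lagrange multipliers for a convex program with one convex inequality constraint satisfying a
Slater condition and one linear equality constraint. -/
theorem exists_lagrange_multipliers {E : Type*} [NormedAddCommGroup E] [NormedSpace ℝ E]
    [CompleteSpace E] {g : E → ℝ} (hg : ConvexOn ℝ Set.univ g) (hgc : Continuous g)
    (a v : E →L[ℝ] ℝ) (ha : Function.Surjective a) {β m : ℝ}
    (slater : ∃ x, g x < β ∧ a x = 0) (hm : ∀ x, g x ≤ β → a x = 0 → m ≤ v x) :
    ∃ l : ℝ, 0 ≤ l ∧ ∃ μ : ℝ, ∀ x, m ≤ v x + μ * a x + l * (g x - β) := by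
  let S : Set (E × ℝ × ℝ) := {z | g z.1 - β < z.2.1 ∧ v z.1 < z.2.2}
  let T : E × ℝ × ℝ →L[ℝ] ℝ × ℝ × ℝ :=
    ((ContinuousLinearMap.fst ℝ ℝ ℝ).comp (ContinuousLinearMap.snd ℝ E (ℝ × ℝ))).prod
      ((a.comp (ContinuousLinearMap.fst ℝ E (ℝ × ℝ))).prod
        ((ContinuousLinearMap.snd ℝ ℝ ℝ).comp (ContinuousLinearMap.snd ℝ E (ℝ × ℝ))))
  have hT : ∀ z, T z = (z.2.1, a z.1, z.2.2) := fun _ => rfl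
  have hTs : Function.Surjective T := by
    rintro ⟨s, t, r⟩
    obtain ⟨x, hx⟩ := ha t
    exact ⟨(x, s, r), by simp [hT, hx]⟩
  have hSo : IsOpen S := by
    have h₁ : IsOpen {z : E × ℝ × ℝ | g z.1 - β < z.2.1} := isOpen_lt (by fun_prop) (by fun_prop)
    have h₂ : IsOpen {z : E × ℝ × ℝ | v z.1 < z.2.2} := isOpen_lt (by fun_prop) (by fun_prop)
    exact h₁.inter h₂
  have hSc : Convex ℝ S := by
    rintro ⟨x, s, r⟩ ⟨hx, hx'⟩ ⟨y, s', r'⟩ ⟨hy, hy'⟩ b c hb hc hbc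
    have h := hg.2 (Set.mem_univ x) (Set.mem_univ y) hb hc hbc
    simp only [smul_eq_mul] at h hx hx' hy hy'
    have key : ∀ {p q p' q' : ℝ}, p < q → p' < q' → b * p + c * p' < b * q + c * q' := by
      intro p q p' q' h₁ h₂
      rcases hb.eq_or_lt with rfl | hb'
      · obtain rfl : c = 1 := by linarith
        simpa using h₂
      · exact add_lt_add_of_lt_of_le (mul_lt_mul_of_pos_left h₁ hb')
          (mul_le_mul_of_nonneg_left h₂.le hc)
    constructor
    · have h₁ := key hx hy
      have h₂ : b * β + c * β = β := by rw [← add_mul, hbc, one_mul]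
      simp only [Prod.smul_mk, Prod.mk_add_mk, smul_eq_mul]
      linarith
    · simpa using key hx' hy'
  have hout : ((0, 0, m) : ℝ × ℝ × ℝ) ∉ T '' S := by
    rintro ⟨⟨x, s, r⟩, ⟨h₁, h₂⟩, h⟩
    simp only [hT, Prod.mk.injEq] at h h₁ h₂
    obtain ⟨rfl, h, rfl⟩ := h
    exact absurd (hm x (by linarith) h) (not_le.2 h₂)
  obtain ⟨f, hf⟩ := geometric_hahn_banach_open_point (hSc.linear_image T.toLinearMap)
    (T.isOpenMap hTs S hSo) hout
  set α := f (1, 0, 0)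
  set η := f (0, 1, 0)
  set γ := f (0, 0, 1)
  have hfe : ∀ s t r : ℝ, f (s, t, r) = α * s + η * t + γ * r := by
    intro s t r
    have : ((s, t, r) : ℝ × ℝ × ℝ) =
        s • ((1, 0, 0) : ℝ × ℝ × ℝ) + t • ((0, 1, 0) : ℝ × ℝ × ℝ) + r • ((0, 0, 1) : ℝ × ℝ × ℝ) := by
      simp
    rw [this, map_add, map_add, map_smul, map_smul, map_smul]
    simp only [smul_eq_mul]
    ring
  have hsep : ∀ x s r, g x - β < s → v x < r → α * s + η * a x + γ * r < γ * m := by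
    intro x s r h₁ h₂
    have h := hf _ ⟨(x, s, r), ⟨h₁, h₂⟩, rfl⟩
    change f (s, a x, r) < _ at h
    rw [hfe, hfe] at h
    simpa using h
  obtain ⟨x₀, hx₀, hax₀⟩ := slater
  have hγ : γ < 0 := by
    have h := hsep x₀ 0 (max (v x₀) m + 1) (by linarith)
      ((le_max_left _ _).trans_lt (lt_add_one _))
    rw [hax₀] at h
    have : m < max (v x₀) m + 1 := (le_max_right _ _).trans_lt (lt_add_one _)
    by_contra! h'
    nlinarith
  have hα : α ≤ 0 := by
    by_contra! h'
    set C := γ * m - γ * (v x₀ + 1)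
    have h := hsep x₀ (|C| / α) (v x₀ + 1)
      ((sub_neg.2 hx₀).trans_le (div_nonneg (abs_nonneg C) h'.le)) (lt_add_one _)
    rw [hax₀, mul_div_cancel₀ _ h'.ne'] at h
    have := le_abs_self C
    simp only [C] at this h
    linarith
  refine ⟨α / γ, div_nonneg_of_nonpos hα hγ.le, η / γ, fun x => ?_⟩
  have hle : α * (g x - β) + η * a x + γ * v x ≤ γ * m := by
    refine le_of_forall_pos_le_add fun ε hε => ?_
    have hp : 0 < -(α + γ) := by linarith
    have h := hsep x (g x - β + ε / -(α + γ)) (v x + ε / -(α + γ))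
      (lt_add_of_pos_right _ (by positivity)) (lt_add_of_pos_right _ (by positivity))
    have : -(α + γ) * (ε / -(α + γ)) = ε := mul_div_cancel₀ _ hp.ne'
    linarith
  have : v x + η / γ * a x + α / γ * (g x - β) =
      (α * (g x - β) + η * a x + γ * v x) / γ := by
    have := hγ.ne
    rw [add_div, add_div, mul_div_cancel_left₀ _ this]
    ring
  rw [this, le_div_iff_of_neg hγ]
  linarith

theorem convexOn_lp_dist {ι : Type*} [Fintype ι] {p : ℝ} (hp : 1 ≤ p) (c : ι → ℝ) :
    ConvexOn ℝ Set.univ fun w : ι → ℝ => (∑ j, |w j - c j| ^ p) ^ (1 / p) := by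
  have hp0 : 0 < p := by linarith
  have : Fact (1 ≤ ENNReal.ofReal p) := ⟨by simpa using hp⟩
  have hpr : (ENNReal.ofReal p).toReal = p := ENNReal.toReal_ofReal hp0.le
  have hnorm : ∀ w : ι → ℝ, (∑ j, |w j - c j| ^ p) ^ (1 / p) =
      ‖WithLp.toLp (ENNReal.ofReal p) (w - c)‖ := by
    intro w
    rw [PiLp.norm_eq_sum (by rwa [hpr]), hpr]
    simp
  simp only [hnorm]
  refine ⟨convex_univ, fun x _ y _ a b ha hb hab => ?_⟩
  have : WithLp.toLp (ENNReal.ofReal p) (a • x + b • y - c) =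
      a • WithLp.toLp (ENNReal.ofReal p) (x - c) + b • WithLp.toLp (ENNReal.ofReal p) (y - c) := by
    rw [← WithLp.toLp_smul, ← WithLp.toLp_smul, ← WithLp.toLp_add]
    congr 1
    rw [smul_sub, smul_sub, sub_add_sub_comm, ← add_smul, hab, one_smul]
  beta_reduce
  rw [this]
  refine (norm_add_le _ _).trans_eq ?_
  rw [norm_smul, norm_smul, Real.norm_of_nonneg ha, Real.norm_of_nonneg hb, smul_eq_mul,
    smul_eq_mul]

theorem abs_sub_le_lp_dist {ι : Type*} [Fintype ι] {p : ℝ} (hp : 1 ≤ p) (w c : ι → ℝ) (j : ι) :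
    |w j - c j| ≤ (∑ j, |w j - c j| ^ p) ^ (1 / p) := by
  have hp0 : 0 < p := by linarith
  rw [one_div, Real.le_rpow_inv_iff_of_pos (abs_nonneg _) (by positivity) hp0]
  exact single_le_sum (f := fun j => |w j - c j| ^ p) (fun _ _ => by positivity) (mem_univ j)

theorem convexOn_sum_lp_dist {ι κ : Type*} [Fintype ι] [Fintype κ] {p : ℝ} (hp : 1 ≤ p)
    (u : κ → ι → ℝ) :
    ConvexOn ℝ Set.univ fun w : ι → ℝ => ∑ i, (∑ j, |w j - u i j| ^ p) ^ (1 / p) := by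
  refine ⟨convex_univ, fun x _ y _ a b ha hb hab => ?_⟩
  simp only [smul_sum, ← sum_add_distrib]
  exact sum_le_sum fun i _ => (convexOn_lp_dist hp (u i)).2 trivial trivial ha hb hab

/-- The elliptic uncertainty set is compact. -/
theorem isCompact_elliptic {ι κ : Type*} [Fintype ι] [Fintype κ] [Nonempty κ] {p : ℝ} (hp : 1 ≤ p)
    (u : κ → ι → ℝ) (β : ℝ) :
    IsCompact {w : ι → ℝ |
      (∑ i, (∑ j, |w j - u i j| ^ p) ^ (1 / p)) ≤ β ∧ (∑ j, w j) = 0} := by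
  have hgc : Continuous fun w : ι → ℝ => ∑ i, (∑ j, |w j - u i j| ^ p) ^ (1 / p) :=
    continuousOn_univ.1 ((convexOn_sum_lp_dist hp u).continuousOn isOpen_univ)
  refine Metric.isCompact_of_isClosed_isBounded
    ((isClosed_le hgc continuous_const).inter (isClosed_eq (by fun_prop) continuous_const))
    ((Metric.isBounded_closedBall (x := u (Classical.arbitrary κ)) (r := max β 0)).subset
      fun w hw => ?_)
  rw [Metric.mem_closedBall, dist_pi_le_iff (le_max_right _ _)]
  intro j
  refine le_trans ?_ (hw.1.trans (le_max_left _ _))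
  rw [Real.dist_eq]
  exact (abs_sub_le_lp_dist hp w _ j).trans
    (single_le_sum (f := fun i => (∑ j, |w j - u i j| ^ p) ^ (1 / p))
      (fun _ _ => by positivity) (mem_univ _))

/-- Strong duality for minimizing a linear functional over the elliptic
uncertainty set `{u : ∑ i ‖u - u i‖_p ≤ β, 𝟙ᵀu = 0}` under a Slater condition:
the minimum is attained and equals the supremum of the Lagrangian dual values
`-λβ + inf_u [(v + μ𝟙)ᵀu + λ ∑ i ‖u - u i‖_p]` over `λ ≥ 0`, `μ ∈ ℝ`. -/
theorem elliptic_strong_duality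
    (d N : ℕ) (hd : 1 ≤ d) (hN : 1 ≤ N) (p : ℝ) (hp : 1 ≤ p)
    (v : Fin d → ℝ) (u : Fin N → Fin d → ℝ) (β : ℝ) (hβ : 0 < β)
    (slater : ∃ u0 : Fin d → ℝ,
      (∑ i, (∑ j, |u0 j - u i j| ^ p) ^ (1 / p)) < β ∧ (∑ j, u0 j) = 0) :
    ∃ ustar : Fin d → ℝ,
      ((∑ i, (∑ j, |ustar j - u i j| ^ p) ^ (1 / p)) ≤ β ∧ (∑ j, ustar j) = 0) ∧
      (∀ w : Fin d → ℝ,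
        (∑ i, (∑ j, |w j - u i j| ^ p) ^ (1 / p)) ≤ β → (∑ j, w j) = 0 →
          (∑ j, v j * ustar j) ≤ ∑ j, v j * w j) ∧
      ((∑ j, v j * ustar j : ℝ) : EReal) =
        ⨆ (lam : {l : ℝ // 0 ≤ l}) (μ : ℝ),
          (((-(lam : ℝ) * β : ℝ) : EReal) +
            ⨅ (w : Fin d → ℝ),
              (((∑ j, (v j + μ) * w j) +
                 (lam : ℝ) * ∑ i, (∑ j, |w j - u i j| ^ p) ^ (1 / p) : ℝ) : EReal)) := by
  have : Nonempty (Fin N) := ⟨⟨0, hN⟩⟩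
  have hconv : ConvexOn ℝ Set.univ fun w : Fin d → ℝ =>
      ∑ i, (∑ j, |w j - u i j| ^ p) ^ (1 / p) :=
    convexOn_sum_lp_dist hp u
  obtain ⟨u0, hu0, hu0'⟩ := slater
  obtain ⟨ustar, hmem, hmin⟩ := (isCompact_elliptic hp u β).exists_isMinOn
    ⟨u0, hu0.le, hu0'⟩ (f := fun w => ∑ j, v j * w j) (by fun_prop)
  have hopt : ∀ w : Fin d → ℝ,
      (∑ i, (∑ j, |w j - u i j| ^ p) ^ (1 / p)) ≤ β → (∑ j, w j) = 0 →
        (∑ j, v j * ustar j) ≤ ∑ j, v j * w j := fun w h₁ h₂ => hmin ⟨h₁, h₂⟩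
  refine ⟨ustar, hmem, hopt, le_antisymm ?_ ?_⟩
  · let L : (Fin d → ℝ) → (Fin d → ℝ) →L[ℝ] ℝ := fun c => ∑ j, c j • ContinuousLinearMap.proj j
    have hL : ∀ c w, L c w = ∑ j, c j * w j := by simp [L]
    obtain ⟨l, hl, μ, h⟩ := exists_lagrange_multipliers hconv
      (continuousOn_univ.1 (hconv.continuousOn isOpen_univ)) (L 1) (L v)
      (fun t => ⟨Pi.single ⟨0, hd⟩ t, by simp [hL]⟩)
      ⟨u0, hu0, by simpa [hL] using hu0'⟩
      (m := ∑ j, v j * ustar j)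
      (fun w h₁ h₂ => by simpa [hL] using hopt w h₁ (by simpa [hL] using h₂))
    refine le_iSup₂_of_le (⟨l, hl⟩ : {l : ℝ // 0 ≤ l}) μ ?_
    have hsplit : ∑ j, v j * ustar j = -l * β + (∑ j, v j * ustar j + l * β) := by ring
    rw [hsplit, EReal.coe_add]
    refine add_le_add le_rfl (le_iInf fun w => EReal.coe_le_coe_iff.2 ?_)
    have h := h w
    simp only [hL, Pi.one_apply, one_mul] at h
    simp only [add_mul, sum_add_distrib, ← mul_sum]
    linarith
  · refine iSup₂_le fun l μ => (add_le_add le_rfl (iInf_le _ ustar)).trans ?_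
    rw [← EReal.coe_add, EReal.coe_le_coe_iff]
    have h := mul_le_mul_of_nonneg_left hmem.1 l.2
    simp only [add_mul, sum_add_distrib, ← mul_sum, hmem.2]
    linarith
end

section
/- Let d ≥ 2, let p ∈ (1, ∞) with conjugate exponent q (1/p + 1/q = 1), let β ≥ 0, let u_1 ∈ ℝ^d satisfy 𝟙ᵀu_1 = 0, and let v ∈ ℝ^d not be a scalar multiple of 𝟙. Let μ* ∈ ℝ be a minimizer of μ ↦ ‖v + μ𝟙‖_q, set w = v + μ*𝟙 (which is nonzero), and define u* ∈ ℝ^d coordinatewise by u*_j = (u_1)_j − β · sign(w_j)|w_j|^{q−1} / ‖w‖_q^{q−1}. Then u* lies in the feasible set {u ∈ ℝ^d : ‖u − u_1‖_p ≤ β, 𝟙ᵀu = 0}, and u* minimizes vᵀu over this set, with minimum value vᵀu_1 − β · min_{μ ∈ ℝ} ‖v + μ𝟙‖_q. -/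
open Finset

namespace Real

theorem sign_mul_abs_rpow_sub_one (x q : ℝ) :
    sign x * |x| ^ (q - 1) = |x| ^ (q - 2) * x := by
  rcases eq_or_ne x 0 with rfl | hx
  · simp
  · have h : |x| ^ (q - 1) = |x| ^ (q - 2) * |x| := by
      rw [← rpow_add_one (abs_ne_zero.mpr hx)]
      ring_nf
    rw [h, mul_left_comm]
    rcases hx.lt_or_gt with hx | hx
    · rw [sign_of_neg hx, abs_of_neg hx]
      ring
    · rw [sign_of_pos hx, abs_of_pos hx, one_mul]

theorem mul_sign_mul_abs_rpow_sub_one (x : ℝ) {q : ℝ} (hq : q ≠ 0) :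
    x * (sign x * |x| ^ (q - 1)) = |x| ^ q := by
  rcases eq_or_ne x 0 with rfl | hx
  · simp [zero_rpow hq]
  · have h : |x| ^ q = |x| ^ (q - 1) * |x| := by
      rw [← rpow_add_one (abs_ne_zero.mpr hx)]
      ring_nf
    rw [h]
    rcases hx.lt_or_gt with hx | hx
    · rw [sign_of_neg hx, abs_of_neg hx]
      ring
    · rw [sign_of_pos hx, abs_of_pos hx]
      ring

theorem HolderConjugate.abs_sign_mul_abs_rpow_sub_one_rpow {p q : ℝ}
    (h : p.HolderConjugate q) (x : ℝ) :
    |sign x * |x| ^ (q - 1)| ^ p = |x| ^ q := by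
  rcases eq_or_ne x 0 with rfl | hx
  · simp [zero_rpow h.ne_zero, zero_rpow h.symm.ne_zero]
  · have hs : |sign x| = 1 := by
      rcases hx.lt_or_gt with hx | hx
      · simp [sign_of_neg hx]
      · simp [sign_of_pos hx]
    rw [abs_mul, hs, one_mul, abs_of_nonneg (by positivity), ← rpow_mul (abs_nonneg x),
      h.symm.sub_one_mul_conj]

/-- First-order optimality condition for a translate of least `ℓq` norm. -/
theorem sum_sign_mul_abs_rpow_eq_zero_of_forall_le {ι : Type*} [Fintype ι] {q : ℝ} (hq : 1 < q)
    (v : ι → ℝ) (m : ℝ)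
    (hm : ∀ μ : ℝ, ∑ j, |v j + m| ^ q ≤ ∑ j, |v j + μ| ^ q) :
    ∑ j, sign (v j + m) * |v j + m| ^ (q - 1) = 0 := by
  have hd : HasDerivAt (fun μ : ℝ => ∑ j, |v j + μ| ^ q)
      (∑ j, q * |v j + m| ^ (q - 2) * (v j + m)) m := by
    refine HasDerivAt.fun_sum fun j _ => ?_
    exact (hasDerivAt_abs_rpow (v j + m) hq).comp_const_add (v j) m
  have h0 := IsLocalMin.hasDerivAt_eq_zero (Filter.Eventually.of_forall hm) hd
  simp only [mul_assoc, ← Finset.mul_sum] at h0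
  simp only [sign_mul_abs_rpow_sub_one]
  exact (mul_eq_zero.mp h0).resolve_left (by linarith)

end Real

/-- Explicit worst-case uncertainty for the single-focus (`N = 1`) `ℓp`-ball
uncertainty set intersected with the zero-sum hyperplane: the explicitly
defined `u*` is feasible and minimizes `vᵀu`, with minimum value
`vᵀu₁ - β ⬝ min_μ ‖v + μ𝟙‖_q`. -/
theorem explicit_solution_single_focus
    (d : ℕ) (hd : 2 ≤ d) (p q : ℝ) (hp : 1 < p) (hpq : 1 / p + 1 / q = 1)
    (β : ℝ) (hβ : 0 ≤ β) (u1 v : Fin d → ℝ) (hu1 : (∑ j, u1 j) = 0)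
    (hv : ∀ c : ℝ, v ≠ fun _ => c)
    (μstar : ℝ)
    (hμstar : ∀ μ : ℝ,
      (∑ j, |v j + μstar| ^ q) ^ (1 / q) ≤ (∑ j, |v j + μ| ^ q) ^ (1 / q))
    (w : Fin d → ℝ) (hw : w = fun j => v j + μstar)
    (ustar : Fin d → ℝ)
    (hustar : ustar = fun j =>
      u1 j - β * (Real.sign (w j) * |w j| ^ (q - 1)) /
        ((∑ k, |w k| ^ q) ^ (1 / q)) ^ (q - 1)) :
    w ≠ 0 ∧
    ((∑ j, |ustar j - u1 j| ^ p) ^ (1 / p) ≤ β ∧ (∑ j, ustar j) = 0) ∧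
    (∀ u : Fin d → ℝ,
      (∑ j, |u j - u1 j| ^ p) ^ (1 / p) ≤ β → (∑ j, u j) = 0 →
        (∑ j, v j * ustar j) ≤ ∑ j, v j * u j) ∧
    (∑ j, v j * ustar j) =
      (∑ j, v j * u1 j) - β * (∑ j, |v j + μstar| ^ q) ^ (1 / q) := by
  have hc : p.HolderConjugate q := by
    rw [Real.holderConjugate_iff]
    exact ⟨hp, by simpa [one_div] using hpq⟩
  have hq0 : 0 < q := hc.symm.pos
  have hw0 : w ≠ 0 := by
    intro h
    refine hv (-μstar) (funext fun j => ?_)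
    have := congrFun (hw.symm.trans h) j
    simp only [Pi.zero_apply] at this
    linarith
  have hwj : ∀ j, v j = w j - μstar := fun j => by rw [hw]; ring
  have hvw : ∀ u : Fin d → ℝ, ∑ j, u j = 0 → ∑ j, v j * u j = ∑ j, w j * u j := by
    intro u hu
    simp only [hwj, sub_mul, Finset.sum_sub_distrib, ← Finset.mul_sum, hu, mul_zero, sub_zero]
  have hg : ∑ j, Real.sign (w j) * |w j| ^ (q - 1) = 0 := by
    rw [hw]
    refine Real.sum_sign_mul_abs_rpow_eq_zero_of_forall_le hc.symm.lt v μstar fun μ => ?_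
    exact (Real.rpow_le_rpow_iff (by positivity) (by positivity) (by positivity)).mp (hμstar μ)
  have hS : 0 < ∑ j, |w j| ^ q := by
    obtain ⟨j, hj⟩ := Function.ne_iff.mp hw0
    exact Finset.sum_pos' (fun i _ => by positivity)
      ⟨j, Finset.mem_univ j, Real.rpow_pos_of_pos (abs_pos.mpr hj) q⟩
  have hN : (∑ j, |v j + μstar| ^ q) ^ (1 / q) = (∑ j, |w j| ^ q) ^ (1 / q) := by rw [hw]
  rw [hN]
  set N : ℝ := (∑ j, |w j| ^ q) ^ (1 / q) with hNdef
  have hNpos : 0 < N := Real.rpow_pos_of_pos hS _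
  have hNq : N ^ q = ∑ j, |w j| ^ q := by
    rw [hNdef, one_div, Real.rpow_inv_rpow hS.le hq0.ne']
  set g : Fin d → ℝ := fun j => Real.sign (w j) * |w j| ^ (q - 1) with hgdef
  have hus : ∀ j, ustar j = u1 j - β / N ^ (q - 1) * g j := fun j => by
    rw [hustar, hgdef]
    ring
  have hsum : ∑ j, ustar j = 0 := by
    simp only [hus, Finset.sum_sub_distrib, ← Finset.mul_sum, hu1]
    rw [hg]
    ring
  have hnorm : ∑ j, |ustar j - u1 j| ^ p = β ^ p := by
    have hterm : ∀ j, |ustar j - u1 j| ^ p = β ^ p / N ^ q * |w j| ^ q := fun j => by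
      have hcoef : 0 ≤ β / N ^ (q - 1) := by positivity
      rw [hus, sub_sub_cancel_left, abs_neg, abs_mul, abs_of_nonneg hcoef,
        Real.mul_rpow hcoef (abs_nonneg _), hc.abs_sign_mul_abs_rpow_sub_one_rpow,
        Real.div_rpow hβ (by positivity), ← Real.rpow_mul hNpos.le, hc.symm.sub_one_mul_conj]
    simp only [hterm, ← Finset.mul_sum]
    rw [← hNq, div_mul_cancel₀ _ (by positivity)]
  have hval : ∑ j, v j * ustar j = ∑ j, v j * u1 j - β * N := by
    have hwg : ∑ j, w j * g j = N ^ q := by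
      rw [hNq]
      exact Finset.sum_congr rfl fun j _ => Real.mul_sign_mul_abs_rpow_sub_one (w j) hq0.ne'
    have hpow : N ^ q = N ^ (q - 1) * N := by
      rw [← Real.rpow_add_one hNpos.ne', sub_add_cancel]
    simp only [hus, mul_sub, Finset.sum_sub_distrib, mul_left_comm (v _), ← Finset.mul_sum]
    rw [hvw g hg, hwg, hpow]
    field_simp
  refine ⟨hw0, ⟨?_, hsum⟩, fun u hu hu0 => ?_, hval⟩
  · rw [hnorm, one_div, Real.rpow_rpow_inv hβ hc.ne_zero]
  · have hdiff : ∑ j, (u1 j - u j) = 0 := by rw [Finset.sum_sub_distrib, hu1, hu0, sub_zero]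
    have hHolder := Real.inner_le_Lp_mul_Lq Finset.univ w (fun j => u1 j - u j) hc.symm
    simp only [abs_sub_comm (u1 _)] at hHolder
    have hle : ∑ j, w j * (u1 j - u j) ≤ N * β :=
      hHolder.trans (mul_le_mul_of_nonneg_left hu hNpos.le)
    rw [← hvw _ hdiff] at hle
    simp only [mul_sub, Finset.sum_sub_distrib] at hle
    linarith
end

section
/- Let u_1, u_2, w ∈ ℝ and λ > 0 with |w| ≤ 2λ. Then min_{u ∈ ℝ} ( uw + λ(|u − u_1| + |u − u_2|) ) = w·(u_1 + u_2)/2 + (λ − |w|/2)·|u_1 − u_2|. -/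
/-- One-dimensional two-point minimization: for `λ > 0` and `|w| ≤ 2λ`,
`min_u ( uw + λ(|u - u₁| + |u - u₂|) ) = w(u₁ + u₂)/2 + (λ - |w|/2)|u₁ - u₂|`. -/
theorem one_dim_two_point_min
    (u1 u2 w lam : ℝ) (hlam : 0 < lam) (hw : |w| ≤ 2 * lam) :
    IsLeast (Set.range fun u : ℝ => u * w + lam * (|u - u1| + |u - u2|))
      (w * (u1 + u2) / 2 + (lam - |w| / 2) * |u1 - u2|) := by
  constructor
  · rcases le_total 0 w with h | h <;> rcases le_total u1 u2 with h' | h'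
    · refine ⟨u1, ?_⟩
      simp only [sub_self, abs_zero, abs_of_nonneg h, abs_of_nonpos (sub_nonpos.2 h')]
      ring
    · refine ⟨u2, ?_⟩
      simp only [sub_self, abs_zero, abs_of_nonneg h, abs_sub_comm u2 u1,
        abs_of_nonneg (sub_nonneg.2 h')]
      ring
    · refine ⟨u2, ?_⟩
      simp only [sub_self, abs_zero, abs_of_nonpos h, abs_sub_comm u2 u1,
        abs_of_nonpos (sub_nonpos.2 h')]
      ring
    · refine ⟨u1, ?_⟩
      simp only [sub_self, abs_zero, abs_of_nonpos h, abs_of_nonneg (sub_nonneg.2 h')]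
      ring
  · rintro _ ⟨u, rfl⟩
    have hdist : |u1 - u2| ≤ |u - u1| + |u - u2| := by
      simpa only [abs_sub_comm u1 u] using abs_sub_le u1 u u2
    have hmid : |(u - u1) + (u - u2)| ≤ |u - u1| + |u - u2| := abs_add_le _ _
    have hlin : -(|w| * |(u - u1) + (u - u2)|) ≤ w * ((u - u1) + (u - u2)) := by
      rw [← abs_mul]
      exact neg_abs_le _
    have hslope := mul_le_mul_of_nonneg_left hmid (abs_nonneg w)
    have hcoef := mul_le_mul_of_nonneg_left hdist (show 0 ≤ lam - |w| / 2 by linarith)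
    dsimp only
    linarith
end

section
/- Let N ≥ 1, let λ > 0, let w ∈ ℝ with |w| < λN, and let u : {1, …, N} → ℝ be nondecreasing (u_{(1)} ≤ u_{(2)} ≤ … ≤ u_{(N)}). Define f(t) = tw + λ ∑_{i=1}^N |t − u_{(i)}| and k* = ⌈(N − w/λ)/2⌉. Then 1 ≤ k* ≤ N and u_{(k*)} is a global minimizer of f, i.e., f(u_{(k*)}) ≤ f(t) for all t ∈ ℝ. -/
open Finset

theorem sum_ite_one_neg_one {ι : Type*} [Fintype ι] (p : ι → Prop) [DecidablePred p] :
    ∑ i, (if p i then (1 : ℝ) else -1) = 2 * #{i | p i} - Fintype.card ι := by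
  have h (i : ι) : (if p i then (1 : ℝ) else -1) = 2 * (if p i then 1 else 0) - 1 := by
    split_ifs <;> norm_num
  simp_rw [h, sum_sub_distrib, ← mul_sum]
  simp

theorem sum_abs_sub_add_le_of_le {N : ℕ} {u : Fin N → ℝ} (hu : Monotone u) (j : Fin N)
    {t : ℝ} (ht : u j ≤ t) :
    ∑ i, |u j - u i| + (2 * (j + 1 : ℝ) - N) * (t - u j) ≤ ∑ i, |t - u i| := by
  have hc : ∑ i, (if i ≤ j then (1 : ℝ) else -1) = 2 * (j + 1 : ℝ) - N := by
    simp [sum_ite_one_neg_one, filter_ge_eq_Iic]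
  rw [← hc, sum_mul, ← sum_add_distrib]
  refine sum_le_sum fun i _ => ?_
  split_ifs with h
  · have hi := hu h
    rw [abs_of_nonneg (sub_nonneg.2 hi), abs_of_nonneg (by linarith)]
    linarith
  · have := abs_sub_le (u j) t (u i)
    rw [abs_of_nonpos (sub_nonpos.2 ht)] at this
    linarith

theorem sum_abs_sub_add_le_of_ge {N : ℕ} {u : Fin N → ℝ} (hu : Monotone u) (j : Fin N)
    {t : ℝ} (ht : t ≤ u j) :
    ∑ i, |u j - u i| + (2 * (j : ℝ) - N) * (t - u j) ≤ ∑ i, |t - u i| := by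
  have hc : ∑ i, (if i < j then (1 : ℝ) else -1) = 2 * (j : ℝ) - N := by
    simp [sum_ite_one_neg_one, filter_gt_eq_Iio]
  rw [← hc, sum_mul, ← sum_add_distrib]
  refine sum_le_sum fun i _ => ?_
  split_ifs with h
  · have := abs_sub_le (u j) t (u i)
    rw [abs_of_nonneg (sub_nonneg.2 ht)] at this
    linarith
  · have hi := hu (not_lt.1 h)
    rw [abs_of_nonpos (sub_nonpos.2 hi), abs_of_nonpos (by linarith)]
    linarith

/-- Weighted-median minimization: for `λ > 0`, `|w| < λN`, and nondecreasing
values `u₍₁₎ ≤ … ≤ u₍N₎`, the order statistic `u₍k*₎` with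
`k* = ⌈(N - w/λ)/2⌉` globally minimizes `f(t) = tw + λ ∑ᵢ |t - u₍ᵢ₎|`. -/
theorem weighted_median_minimizer
    (N : ℕ) (hN : 1 ≤ N) (lam : ℝ) (hlam : 0 < lam)
    (w : ℝ) (hw : |w| < lam * N)
    (u : Fin N → ℝ) (hu : Monotone u)
    (kstar : ℤ) (hkstar : kstar = ⌈(((N : ℝ) - w / lam) / 2)⌉) :
    1 ≤ kstar ∧ kstar ≤ (N : ℤ) ∧
    ∀ (hk1 : 1 ≤ kstar) (hk2 : kstar ≤ (N : ℤ)) (t : ℝ),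
      (u ⟨kstar.toNat - 1, by omega⟩) * w +
          lam * ∑ i, |u ⟨kstar.toNat - 1, by omega⟩ - u i| ≤
        t * w + lam * ∑ i, |t - u i| := by
  obtain ⟨hw₁, hw₂⟩ := abs_lt.1 hw
  have hlo : -(N : ℝ) < w / lam := by rw [lt_div_iff₀ hlam]; linarith
  have hhi : w / lam < N := by rw [div_lt_iff₀ hlam]; linarith
  refine ⟨?_, ?_, fun hk1 hk2 t => ?_⟩
  · rw [hkstar, Int.one_le_ceil_iff]
    linarith
  · rw [hkstar, Int.ceil_le]
    push_cast
    linarith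
  · generalize_proofs hj
    set j : Fin N := ⟨kstar.toNat - 1, hj⟩ with hjdef
    have hjk : (kstar : ℝ) = (j : ℝ) + 1 := by
      have : kstar = ((j : ℕ) : ℤ) + 1 := by simp only [hjdef]; omega
      exact_mod_cast this
    obtain ⟨hc₁, hc₂⟩ := Int.ceil_eq_iff.1 hkstar.symm
    rw [hjk] at hc₁ hc₂
    have hwl : w = lam * (w / lam) := by field_simp
    rcases le_total (u j) t with ht | ht
    · have hs := mul_le_mul_of_nonneg_left (sum_abs_sub_add_le_of_le hu j ht) hlam.le
      have hslope : 0 ≤ w + lam * (2 * (j + 1 : ℝ) - N) := by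
        rw [hwl, ← mul_add]
        exact mul_nonneg hlam.le (by linarith)
      have := mul_nonneg hslope (sub_nonneg.2 ht)
      linarith
    · have hs := mul_le_mul_of_nonneg_left (sum_abs_sub_add_le_of_ge hu j ht) hlam.le
      have hslope : w + lam * (2 * (j : ℝ) - N) ≤ 0 := by
        rw [hwl, ← mul_add]
        exact mul_nonpos_of_nonneg_of_nonpos hlam.le (by linarith)
      have := mul_nonneg_of_nonpos_of_nonpos hslope (sub_nonpos.2 ht)
      linarith
end

section
/- Let d ≥ 1, let A be a symmetric positive definite d×d real matrix, let v, p̄ ∈ ℝ^d, and let 𝟙 ∈ ℝ^d be the all-ones vector. Define F(μ) = −√((v + μ𝟙)ᵀ A^{−1} (v + μ𝟙)) + (v + μ𝟙)ᵀ p̄ for μ ∈ ℝ, and set α = 𝟙ᵀA^{−1}𝟙, β = vᵀA^{−1}𝟙, γ = vᵀA^{−1}v, δ = 𝟙ᵀp̄. If δ² < α, then F attains its global maximum at the unique maximizer μ* = −β/α + (δ/(α√(α − δ²)))·√(αγ − β²). -/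
open Finset Matrix

/-- The quadratic `μ ↦ (v + μ𝟙)ᵀM(v + μ𝟙)` expanded in powers of `μ`, for symmetric `M`. -/
lemma dotProduct_mulVec_add_const {n : Type*} [Fintype n] {M : Matrix n n ℝ} (hM : M.IsSymm)
    (v : n → ℝ) (μ : ℝ) :
    (fun j => v j + μ) ⬝ᵥ M.mulVec (fun j => v j + μ) =
      ((fun _ => (1 : ℝ)) ⬝ᵥ M.mulVec (fun _ => 1)) * μ ^ 2 +
        2 * (v ⬝ᵥ M.mulVec (fun _ => 1)) * μ + v ⬝ᵥ M.mulVec v := by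
  have hsplit : (fun j => v j + μ) = v + μ • (fun _ => (1 : ℝ)) := by
    ext j; simp
  have hcomm : (fun _ => (1 : ℝ)) ⬝ᵥ M.mulVec v = v ⬝ᵥ M.mulVec (fun _ => 1) := by
    rw [dotProduct_mulVec, ← mulVec_transpose, hM.eq, dotProduct_comm]
  rw [hsplit]
  simp only [mulVec_add, mulVec_smul, dotProduct_add, add_dotProduct, smul_dotProduct,
    dotProduct_smul, smul_eq_mul, hcomm]
  ring

/-- A linear function minus the square root of a nonnegative quadratic of discriminant `≤ 0`
is maximized exactly at the explicit critical point. -/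
lemma linear_sub_sqrt_quadratic_maximizer {α β γ δ : ℝ} (hδ : δ ^ 2 < α)
    (hdisc : 0 ≤ α * γ - β ^ 2) {m : ℝ}
    (hm : m = -β / α + (δ / (α * √(α - δ ^ 2))) * √(α * γ - β ^ 2)) (μ : ℝ) :
    -√(α * μ ^ 2 + 2 * β * μ + γ) + μ * δ ≤ -√(α * m ^ 2 + 2 * β * m + γ) + m * δ ∧
      (-√(α * μ ^ 2 + 2 * β * μ + γ) + μ * δ = -√(α * m ^ 2 + 2 * β * m + γ) + m * δ →
        μ = m) := by
  have hα : 0 < α := (sq_nonneg δ).trans_lt hδ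
  set e := √(α - δ ^ 2) with he_def
  set r := √(α * γ - β ^ 2) with hr_def
  have he : 0 < e := Real.sqrt_pos.2 (sub_pos.2 hδ)
  have hr : 0 ≤ r := Real.sqrt_nonneg _
  have he2 : e ^ 2 = α - δ ^ 2 := Real.sq_sqrt (sub_nonneg.2 hδ.le)
  have hr2 : r ^ 2 = α * γ - β ^ 2 := Real.sq_sqrt hdisc
  have hquad (x : ℝ) : (α * √(α * x ^ 2 + 2 * β * x + γ)) ^ 2 =
      (δ * (α * x + β) + r * e) ^ 2 + (e * (α * x + β) - δ * r) ^ 2 := by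
    have hnonneg : 0 ≤ α * x ^ 2 + 2 * β * x + γ := by
      refine nonneg_of_mul_nonneg_right (a := α) ?_ hα
      nlinarith [sq_nonneg (α * x + β)]
    rw [mul_pow, Real.sq_sqrt hnonneg]
    linear_combination (-(α * x + β) ^ 2 - r ^ 2) * he2 - α * hr2
  have hcrit : e * (α * m + β) = δ * r := by
    rw [hm]; field_simp; ring
  have hmax : α * √(α * m ^ 2 + 2 * β * m + γ) = δ * (α * m + β) + r * e := by
    have hnonneg : 0 ≤ δ * (α * m + β) + r * e := by
      refine nonneg_of_mul_nonneg_right (a := e) ?_ he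
      have : e * (δ * (α * m + β) + r * e) = (δ ^ 2 + e ^ 2) * r := by
        linear_combination δ * hcrit
      rw [this]; positivity
    refine (sq_eq_sq₀ (by positivity) hnonneg).1 ?_
    rw [hquad, hcrit]; ring
  constructor
  · have hle : δ * (α * μ + β) + r * e ≤ α * √(α * μ ^ 2 + 2 * β * μ + γ) := by
      refine le_of_sq_le_sq ?_ (by positivity)
      rw [hquad]
      exact le_add_of_nonneg_right (sq_nonneg _)
    refine le_of_mul_le_mul_left ?_ hα
    linarith
  · intro heq
    have hμ : α * √(α * μ ^ 2 + 2 * β * μ + γ) = δ * (α * μ + β) + r * e := by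
      linear_combination hmax - α * heq
    have hzero : e * (α * μ + β) - δ * r = 0 := by
      have := hquad μ
      rw [hμ] at this
      exact pow_eq_zero_iff two_ne_zero |>.1 (by linarith)
    refine mul_left_cancel₀ (mul_pos he hα).ne' ?_
    linear_combination hzero - hcrit

/-- Optimal dual shift: for a symmetric positive definite `A` and `δ² < α`,
`F(μ) = -√((v + μ𝟙)ᵀA⁻¹(v + μ𝟙)) + (v + μ𝟙)ᵀp̄` attains its global maximum
at the unique maximizer `μ* = -β/α + (δ/(α√(α - δ²)))·√(αγ - β²)`. -/
theorem optimal_dual_shift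
    (d : ℕ) (hd : 1 ≤ d) (A : Matrix (Fin d) (Fin d) ℝ) (hA : A.PosDef)
    (v pbar : Fin d → ℝ)
    (α β γ δ : ℝ)
    (hα : α = (fun _ => (1 : ℝ)) ⬝ᵥ A⁻¹.mulVec (fun _ => 1))
    (hβ : β = v ⬝ᵥ A⁻¹.mulVec (fun _ => 1))
    (hγ : γ = v ⬝ᵥ A⁻¹.mulVec v)
    (hδ : δ = (fun _ => (1 : ℝ)) ⬝ᵥ pbar)
    (hcond : δ ^ 2 < α)
    (F : ℝ → ℝ)
    (hF : F = fun μ =>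
      -Real.sqrt ((fun j => v j + μ) ⬝ᵥ A⁻¹.mulVec (fun j => v j + μ)) +
        (fun j => v j + μ) ⬝ᵥ pbar)
    (μstar : ℝ)
    (hμstar : μstar = -β / α +
      (δ / (α * Real.sqrt (α - δ ^ 2))) * Real.sqrt (α * γ - β ^ 2)) :
    (∀ μ : ℝ, F μ ≤ F μstar) ∧ (∀ μ : ℝ, F μ = F μstar → μ = μstar) := by
  have hexpand (μ : ℝ) : (fun j => v j + μ) ⬝ᵥ A⁻¹.mulVec (fun j => v j + μ) =
      α * μ ^ 2 + 2 * β * μ + γ := by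
    have hsymm : A⁻¹.IsSymm := by
      simpa [IsHermitian, IsSymm, conjTranspose_eq_transpose_of_trivial] using
        hA.inv.isHermitian
    rw [hα, hβ, hγ, dotProduct_mulVec_add_const hsymm]
  have hlinear (μ : ℝ) : (fun j => v j + μ) ⬝ᵥ pbar = v ⬝ᵥ pbar + μ * δ := by
    simp [hδ, dotProduct, add_mul, Finset.sum_add_distrib, Finset.mul_sum]
  have hαpos : 0 < α := (sq_nonneg δ).trans_lt hcond
  have hdisc : 0 ≤ α * γ - β ^ 2 := by
    have hnonneg : 0 ≤ α * (-β / α) ^ 2 + 2 * β * (-β / α) + γ := by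
      rw [← hexpand]
      simpa using hA.inv.posSemidef.dotProduct_mulVec_nonneg (fun j => v j + -β / α)
    have : α * (α * (-β / α) ^ 2 + 2 * β * (-β / α) + γ) = α * γ - β ^ 2 := by
      field_simp; ring
    rw [← this]; positivity
  have hmaximizer := linear_sub_sqrt_quadratic_maximizer hcond hdisc hμstar
  simp only [hF, hexpand, hlinear]
  exact ⟨fun μ => by linarith [(hmaximizer μ).1],
    fun μ h => (hmaximizer μ).2 (by linarith)⟩
end

section
/- Let d ≥ 2, let p ∈ (1, ∞) with conjugate exponent q (1/p + 1/q = 1), let β ≥ 0, let u_1 ∈ ℝ^d satisfy 𝟙ᵀu_1 = 0, and let v ∈ ℝ^d not be a scalar multiple of 𝟙. Then the minimum of vᵀu over the feasible set {u ∈ ℝ^d : ‖u − u_1‖_p ≤ β, 𝟙ᵀu = 0} is attained and equals vᵀu_1 − β · min_{μ ∈ ℝ} ‖v + μ𝟙‖_q, where the minimum over μ is attained and is strictly positive. -/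
open Finset

/-- A translate of a vector along the all-ones direction with minimal `ℓ^q` norm exists. -/
theorem exists_forall_sum_abs_add_rpow_le {ι : Type*} [Fintype ι] [Nonempty ι] {q : ℝ}
    (hq : 0 < q) (v : ι → ℝ) :
    ∃ m : ℝ, ∀ μ : ℝ, ∑ j, |v j + m| ^ q ≤ ∑ j, |v j + μ| ^ q := by
  have hcont : Continuous fun μ : ℝ => ∑ j, |v j + μ| ^ q :=
    continuous_finsetSum _ fun j _ =>
      (continuous_const.add continuous_id).abs.rpow_const fun _ => Or.inr hq.le
  refine hcont.exists_forall_le ?_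
  obtain ⟨i⟩ := ‹Nonempty ι›
  have habs : Filter.Tendsto (fun μ : ℝ => |v i + μ|) (Filter.cocompact ℝ) Filter.atTop := by
    refine Filter.tendsto_atTop_mono (f := fun μ : ℝ => ‖μ‖ + -|v i|) (fun μ => ?_)
      (Filter.tendsto_atTop_add_const_right _ _ (tendsto_norm_cocompact_atTop (E := ℝ)))
    have h := abs_sub (v i + μ) (v i)
    rw [add_sub_cancel_left] at h
    rw [Real.norm_eq_abs]
    linarith
  refine Filter.tendsto_atTop_mono (fun μ => ?_) ((tendsto_rpow_atTop hq).comp habs)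
  exact single_le_sum (f := fun j => |v j + μ| ^ q)
    (fun j _ => Real.rpow_nonneg (abs_nonneg _) _) (mem_univ i)

/-- First-order condition for minimality of the `ℓ^q` norm along the all-ones direction. -/
theorem sum_abs_rpow_mul_eq_zero_of_forall_le {ι : Type*} [Fintype ι] {q : ℝ} (hq : 1 < q)
    {v : ι → ℝ} {m : ℝ} (hm : ∀ μ : ℝ, ∑ j, |v j + m| ^ q ≤ ∑ j, |v j + μ| ^ q) :
    ∑ j, |v j + m| ^ (q - 2) * (v j + m) = 0 := by
  have hderiv : HasDerivAt (fun μ : ℝ => ∑ j, |v j + μ| ^ q)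
      (∑ j, q * |v j + m| ^ (q - 2) * (v j + m)) m :=
    HasDerivAt.fun_sum fun j _ => (hasDerivAt_abs_rpow (v j + m) hq).comp_const_add (v j) m
  have hmin : IsLocalMin (fun μ : ℝ => ∑ j, |v j + μ| ^ q) m := Filter.Eventually.of_forall hm
  have h := hmin.hasDerivAt_eq_zero hderiv
  simp only [mul_assoc, ← mul_sum] at h
  exact (mul_eq_zero.mp h).resolve_left (by linarith)

/-- The vector dual to `x` satisfies the equality case of Young's inequality. -/
theorem abs_rpow_sub_two_mul_self_mul_self {q : ℝ} (hq : 1 < q) (x : ℝ) :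
    x * (|x| ^ (q - 2) * x) = |x| ^ q := by
  rcases eq_or_ne x 0 with rfl | hx
  · simp [Real.zero_rpow (by linarith : q ≠ 0)]
  · have hx' : 0 < |x| := abs_pos.mpr hx
    calc x * (|x| ^ (q - 2) * x) = |x| ^ (q - 2) * |x| ^ (2 : ℕ) := by rw [sq_abs]; ring
      _ = |x| ^ q := by
        rw [← Real.rpow_natCast, ← Real.rpow_add hx']
        norm_num

theorem abs_abs_rpow_sub_two_mul_self_rpow {p q : ℝ} (hpq : p.HolderConjugate q) (x : ℝ) :
    |(|x| ^ (q - 2) * x)| ^ p = |x| ^ q := by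
  rcases eq_or_ne x 0 with rfl | hx
  · simp [Real.zero_rpow hpq.pos.ne', Real.zero_rpow hpq.symm.pos.ne']
  · have hx' : 0 < |x| := abs_pos.mpr hx
    have h : |(|x| ^ (q - 2) * x)| = |x| ^ (q - 1) := by
      rw [abs_mul, abs_of_nonneg (Real.rpow_nonneg hx'.le _)]
      nth_rewrite 2 [← Real.rpow_one |x|]
      rw [← Real.rpow_add hx']
      ring_nf
    rw [h, ← Real.rpow_mul hx'.le, hpq.symm.sub_one_mul_conj]

/-- Optimal-value form of the single-focus explicit solution: the minimum of
`vᵀu` over `{u : ‖u - u₁‖_p ≤ β, 𝟙ᵀu = 0}` is attained and equals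
`vᵀu₁ - β · min_μ ‖v + μ𝟙‖_q`, where the minimum over `μ` is attained and
strictly positive. -/
theorem optimal_value_single_focus
    (d : ℕ) (hd : 2 ≤ d) (p q : ℝ) (hp : 1 < p) (hpq : 1 / p + 1 / q = 1)
    (β : ℝ) (hβ : 0 ≤ β) (u1 v : Fin d → ℝ) (hu1 : (∑ j, u1 j) = 0)
    (hv : ∀ c : ℝ, v ≠ fun _ => c) :
    ∃ μstar : ℝ,
      (∀ μ : ℝ,
        (∑ j, |v j + μstar| ^ q) ^ (1 / q) ≤ (∑ j, |v j + μ| ^ q) ^ (1 / q)) ∧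
      0 < (∑ j, |v j + μstar| ^ q) ^ (1 / q) ∧
      ∃ ustar : Fin d → ℝ,
        ((∑ j, |ustar j - u1 j| ^ p) ^ (1 / p) ≤ β ∧ (∑ j, ustar j) = 0) ∧
        (∀ u : Fin d → ℝ,
          (∑ j, |u j - u1 j| ^ p) ^ (1 / p) ≤ β → (∑ j, u j) = 0 →
            (∑ j, v j * ustar j) ≤ ∑ j, v j * u j) ∧
        (∑ j, v j * ustar j) =
          (∑ j, v j * u1 j) - β * (∑ j, |v j + μstar| ^ q) ^ (1 / q) := by
  have hconj : p.HolderConjugate q := by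
    rw [Real.holderConjugate_iff]
    exact ⟨hp, by simpa [one_div] using hpq⟩
  have hq : 1 < q := hconj.symm.lt
  have hq0 : 0 < q := hconj.symm.pos
  have hp0 : 0 < p := hconj.pos
  have : Nonempty (Fin d) := ⟨⟨0, by omega⟩⟩
  obtain ⟨m, hm⟩ := exists_forall_sum_abs_add_rpow_le hq0 v
  have hfoc := sum_abs_rpow_mul_eq_zero_of_forall_le hq hm
  have hnn : ∀ μ : ℝ, ∀ j ∈ univ, 0 ≤ |v j + μ| ^ q :=
    fun μ j _ => Real.rpow_nonneg (abs_nonneg _) _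
  set S := ∑ j, |v j + m| ^ q
  have hSpos : 0 < S := by
    refine (sum_nonneg (hnn m)).lt_of_ne' fun h0 => hv (-m) (funext fun j => ?_)
    have hj := (sum_eq_zero_iff_of_nonneg (hnn m)).mp h0 j (mem_univ j)
    have hj' := (Real.rpow_eq_zero (abs_nonneg _) hq0.ne').mp hj
    linarith [abs_eq_zero.mp hj']
  set s : Fin d → ℝ := fun j => |v j + m| ^ (q - 2) * (v j + m)
  have hvs : ∑ j, v j * s j = S := by
    have h : ∑ j, (v j + m) * s j = S :=
      sum_congr rfl fun j _ => abs_rpow_sub_two_mul_self_mul_self hq (v j + m)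
    simpa [add_mul, sum_add_distrib, ← mul_sum, hfoc] using h
  have hsp : ∑ j, |s j| ^ p = S :=
    sum_congr rfl fun j _ => abs_abs_rpow_sub_two_mul_self_rpow hconj (v j + m)
  set c := β * S ^ (-(1 / p)) with hc
  have hc0 : 0 ≤ c := mul_nonneg hβ (Real.rpow_nonneg hSpos.le _)
  have hval : ∑ j, v j * (u1 j - c * s j) = ∑ j, v j * u1 j - β * S ^ (1 / q) := by
    have hpow : S ^ (-(1 / p)) * S = S ^ (1 / q) := by
      nth_rewrite 2 [← Real.rpow_one S]
      rw [← Real.rpow_add hSpos]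
      congr 1
      linarith
    calc ∑ j, v j * (u1 j - c * s j) = ∑ j, v j * u1 j - c * ∑ j, v j * s j := by
          rw [mul_sum, ← sum_sub_distrib]
          exact sum_congr rfl fun j _ => by ring
      _ = _ := by rw [hvs, hc, mul_assoc, hpow]
  refine ⟨m, fun μ => Real.rpow_le_rpow hSpos.le (hm μ) (by positivity),
    Real.rpow_pos_of_pos hSpos _, fun j => u1 j - c * s j, ⟨?_, ?_⟩, fun u hu hu0 => ?_, hval⟩
  · have h : ∀ j, |u1 j - c * s j - u1 j| ^ p = c ^ p * |s j| ^ p := fun j => by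
      rw [sub_sub_cancel_left, abs_neg, abs_mul, abs_of_nonneg hc0,
        Real.mul_rpow hc0 (abs_nonneg _)]
    simp only [h]
    rw [← mul_sum, hsp, Real.mul_rpow (Real.rpow_nonneg hc0 _) hSpos.le, ← Real.rpow_mul hc0,
      mul_one_div_cancel hp0.ne', Real.rpow_one, hc, mul_assoc, ← Real.rpow_add hSpos]
    simp
  · simp [sum_sub_distrib, ← mul_sum, hu1, hfoc]
  · rw [hval]
    have hholder := Real.inner_le_Lp_mul_Lq univ (fun j => -(u j - u1 j)) (fun j => v j + m) hconj
    simp only [abs_neg] at hholder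
    have hle : (∑ j, |u j - u1 j| ^ p) ^ (1 / p) * S ^ (1 / q) ≤ β * S ^ (1 / q) :=
      mul_le_mul_of_nonneg_right hu (Real.rpow_nonneg hSpos.le _)
    have hsum : ∑ j, -(u j - u1 j) * (v j + m) = ∑ j, v j * u1 j - ∑ j, v j * u j := by
      calc ∑ j, -(u j - u1 j) * (v j + m)
          = ∑ j, v j * u1 j - ∑ j, v j * u j + m * (∑ j, u1 j - ∑ j, u j) := by
            rw [← sum_sub_distrib, ← sum_sub_distrib, mul_sum, ← sum_add_distrib]
            exact sum_congr rfl fun j _ => by ring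
        _ = _ := by rw [hu1, hu0]; ring
    linarith
end
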